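/- arXiv:1709.06829 — 2 statements merged into one kernel-verified Lean document; each statement's English description precedes it below -/
import Mathlib

section
/- Let A be an n×n real symmetric matrix, let m > 0 and K ≥ 0 satisfy ‖A − m·|s⟩⟨s|‖ ≤ K in spectral (operator) norm, where |s⟩ = n^{−1/2} Σ_{v=1}^n |v⟩. Let λ₁ be the largest eigenvalue of A with unit eigenvector v₁ and set α = ⟨s, v₁⟩. Then α²·m·(m − 2λ₁) + λ₁² ≤ K²; in particular, if 2λ₁ > m then α² ≥ (λ₁² − K²)/(2λ₁·m − m²). -/
namespace QSearch

/-- `μ` is the largest eigenvalue of `M`. -/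
def IsMaxEigenvalue {n : ℕ} (M : Matrix (Fin n) (Fin n) ℝ) (μ : ℝ) : Prop :=
  (∃ v : Fin n → ℝ, v ≠ 0 ∧ M.mulVec v = μ • v) ∧
    ∀ ν : ℝ, (∃ v : Fin n → ℝ, v ≠ 0 ∧ M.mulVec v = ν • v) → ν ≤ μ

/-- The rank-one projection `|s⟩⟨s|` onto the uniform superposition: all entries `1/n`. -/
noncomputable def sProj (n : ℕ) : Matrix (Fin n) (Fin n) ℝ :=
  Matrix.of fun _ _ => ((n : ℝ))⁻¹

/-- Let `A` be real symmetric with `‖A - m·|s⟩⟨s|‖ ≤ K` in spectral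
norm (`m > 0`, `K ≥ 0`), let `λ₁` be its largest eigenvalue with unit eigenvector `v₁`,
and `α = ⟨s, v₁⟩`. Then `α²·m·(m - 2λ₁) + λ₁² ≤ K²`; in particular, if `2λ₁ > m` then
`α² ≥ (λ₁² - K²)/(2λ₁m - m²)`. -/
theorem statement11 (n : ℕ) (A : Matrix (Fin n) (Fin n) ℝ) (hA : A.IsSymm)
    (m K : ℝ) (hm : 0 < m) (hK : 0 ≤ K)
    (hnorm : ∀ x : Fin n → ℝ,
      Real.sqrt (∑ i, ((A - m • sProj n).mulVec x i) ^ 2) ≤ K * Real.sqrt (∑ i, x i ^ 2))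
    (lam : ℝ) (hmax : IsMaxEigenvalue A lam)
    (v : Fin n → ℝ) (hv : A.mulVec v = lam • v) (hvunit : ∑ i, v i ^ 2 = 1)
    (α : ℝ) (hα : α = ∑ i, (Real.sqrt n)⁻¹ * v i) :
    α ^ 2 * m * (m - 2 * lam) + lam ^ 2 ≤ K ^ 2 ∧
      (m < 2 * lam → (lam ^ 2 - K ^ 2) / (2 * lam * m - m ^ 2) ≤ α ^ 2) := by
  have hn : (n : ℝ) ≠ 0 := by
    rintro h
    obtain rfl : n = 0 := by exact_mod_cast h
    simp at hvunit
  have hα2 : α ^ 2 = (n : ℝ)⁻¹ * (∑ i, v i) ^ 2 := by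
    rw [hα, ← Finset.mul_sum, mul_pow, inv_pow, Real.sq_sqrt n.cast_nonneg]
  have hentry : ∀ i, (A - m • sProj n).mulVec v i = lam * v i - m * ((n : ℝ)⁻¹ * ∑ j, v j) := by
    intro i
    rw [Matrix.sub_mulVec, Matrix.smul_mulVec, hv]
    simp [sProj, Matrix.mulVec, dotProduct, Finset.mul_sum]
  have hsum : ∑ i, ((A - m • sProj n).mulVec v i) ^ 2
      = α ^ 2 * m * (m - 2 * lam) + lam ^ 2 := by
    simp only [hentry, sub_sq, mul_pow lam, Finset.sum_add_distrib, Finset.sum_sub_distrib,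
      ← Finset.mul_sum, ← Finset.sum_mul, hvunit, Finset.sum_const, Finset.card_univ,
      Fintype.card_fin, nsmul_eq_mul, hα2]
    field_simp
    ring
  have hmain : α ^ 2 * m * (m - 2 * lam) + lam ^ 2 ≤ K ^ 2 := by
    have h := hnorm v
    rw [hsum, hvunit, Real.sqrt_one, mul_one] at h
    exact (Real.sqrt_le_left hK).mp h
  refine ⟨hmain, fun hlam => ?_⟩
  have hpos : 0 < 2 * lam * m - m ^ 2 := by nlinarith
  rw [div_le_iff₀ hpos]
  linarith
end QSearch
end

section
/- For p₀ > 1 define f(p₀) = W₀((1−p₀)/(e·p₀)) / W₋₁((1−p₀)/(e·p₀)). Then f(p₀) ∈ (0,1) for all p₀ > 1, f is monotone (increasing) on (1,∞), f(p₀) → 0 as p₀ → 1⁺, and f(p₀) → 1 as p₀ → ∞. -/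
open Filter

theorem hasDerivAt_mul_exp (y : ℝ) :
    HasDerivAt (fun y : ℝ => y * Real.exp y) ((1 + y) * Real.exp y) y := by
  refine ((hasDerivAt_id' y).mul (Real.hasDerivAt_exp y)).congr_deriv ?_
  ring

theorem strictMonoOn_mul_exp :
    StrictMonoOn (fun y : ℝ => y * Real.exp y) (Set.Ici (-1)) := by
  refine strictMonoOn_of_deriv_pos (convex_Ici _) (by fun_prop) fun y hy => ?_
  rw [interior_Ici, Set.mem_Ioi] at hy
  rw [(hasDerivAt_mul_exp y).deriv]
  exact mul_pos (by linarith) (Real.exp_pos y)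

theorem strictAntiOn_mul_exp :
    StrictAntiOn (fun y : ℝ => y * Real.exp y) (Set.Iic (-1)) := by
  refine strictAntiOn_of_deriv_neg (convex_Iic _) (by fun_prop) fun y hy => ?_
  rw [interior_Iic, Set.mem_Iio] at hy
  rw [(hasDerivAt_mul_exp y).deriv]
  exact mul_neg_of_neg_of_pos (by linarith) (Real.exp_pos y)

theorem neg_one_mul_exp_neg_one : (-1 : ℝ) * Real.exp (-1) = -(Real.exp 1)⁻¹ := by
  rw [Real.exp_neg, neg_one_mul]

theorem one_sub_div_exp_one_mul {p : ℝ} (hp : p ≠ 0) :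
    (1 - p) / (Real.exp 1 * p) = (Real.exp 1)⁻¹ * (p⁻¹ - 1) := by
  field_simp

theorem one_sub_div_exp_one_mul_mem_Ioo {p : ℝ} (hp : 1 < p) :
    (1 - p) / (Real.exp 1 * p) ∈ Set.Ioo (-(Real.exp 1)⁻¹) 0 := by
  have he : 0 < (Real.exp 1)⁻¹ := inv_pos.2 (Real.exp_pos 1)
  have h0 : 0 < p⁻¹ := by positivity
  have h1 : p⁻¹ < 1 := inv_lt_one_of_one_lt₀ hp
  rw [one_sub_div_exp_one_mul (by positivity)]
  constructor <;> nlinarith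

theorem one_sub_div_exp_one_mul_strictAntiOn :
    StrictAntiOn (fun p : ℝ => (1 - p) / (Real.exp 1 * p)) (Set.Ioi 1) := by
  intro p hp q hq hpq
  rw [Set.mem_Ioi] at hp hq
  have h : q⁻¹ < p⁻¹ := inv_strictAnti₀ (by positivity) hpq
  simp only [one_sub_div_exp_one_mul (show p ≠ 0 by positivity),
    one_sub_div_exp_one_mul (show q ≠ 0 by positivity)]
  gcongr

theorem tendsto_one_sub_div_exp_one_mul_atTop :
    Tendsto (fun p : ℝ => (1 - p) / (Real.exp 1 * p)) atTop (nhds (-(Real.exp 1)⁻¹)) := by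
  have h : Tendsto (fun p : ℝ => (Real.exp 1)⁻¹ * (p⁻¹ - 1)) atTop
      (nhds ((Real.exp 1)⁻¹ * (0 - 1))) :=
    (tendsto_inv_atTop_zero.sub_const 1).const_mul _
  rw [zero_sub, mul_neg_one] at h
  refine h.congr' ?_
  filter_upwards [eventually_ne_atTop 0] with p hp
  rw [one_sub_div_exp_one_mul hp]

/-- Let `W0` and `Wm1` be the two real branches of the Lambert W
function on `(-1/e, 0)` (characterized by `W0 x ∈ [-1,0)`, `Wm1 x ≤ -1`, and
`y·e^y = x` for `y = W0 x, Wm1 x`). For `p₀ > 1` define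
`f p₀ = W0((1-p₀)/(e·p₀)) / Wm1((1-p₀)/(e·p₀))`. Then `f p₀ ∈ (0,1)` for all `p₀ > 1`,
`f` is (strictly) increasing on `(1,∞)`, `f → 0` as `p₀ → 1⁺` and `f → 1` as
`p₀ → ∞`. -/
theorem statement17 (W0 Wm1 : ℝ → ℝ)
    (hW0 : ∀ x ∈ Set.Ioo (-(Real.exp 1)⁻¹) 0,
      W0 x ∈ Set.Ico (-1 : ℝ) 0 ∧ W0 x * Real.exp (W0 x) = x)
    (hWm1 : ∀ x ∈ Set.Ioo (-(Real.exp 1)⁻¹) 0,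
      Wm1 x ≤ -1 ∧ Wm1 x * Real.exp (Wm1 x) = x)
    (f : ℝ → ℝ)
    (hf : ∀ p₀ : ℝ, f p₀ =
      W0 ((1 - p₀) / (Real.exp 1 * p₀)) / Wm1 ((1 - p₀) / (Real.exp 1 * p₀))) :
    (∀ p₀ : ℝ, 1 < p₀ → f p₀ ∈ Set.Ioo (0 : ℝ) 1) ∧
    StrictMonoOn f (Set.Ioi (1 : ℝ)) ∧
    Tendsto f (nhdsWithin 1 (Set.Ioi (1 : ℝ))) (nhds 0) ∧
    Tendsto f atTop (nhds 1) := by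
  have hx := fun (p : ℝ) (hp : 1 < p) => one_sub_div_exp_one_mul_mem_Ioo hp
  set x : ℝ → ℝ := fun p => (1 - p) / (Real.exp 1 * p) with hxdef
  replace hf : ∀ p, f p = -W0 (x p) / -Wm1 (x p) := fun p => by rw [hf, neg_div_neg_eq]
  have hm0 : ∀ p, 1 < p → -1 ≤ W0 (x p) := fun p hp => (hW0 _ (hx p hp)).1.1
  have hneg : ∀ p, 1 < p → W0 (x p) < 0 := fun p hp => (hW0 _ (hx p hp)).1.2
  have he0 : ∀ p, 1 < p → W0 (x p) * Real.exp (W0 (x p)) = x p :=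
    fun p hp => (hW0 _ (hx p hp)).2
  have hm1 : ∀ p, 1 < p → Wm1 (x p) ≤ -1 := fun p hp => (hWm1 _ (hx p hp)).1
  have he1 : ∀ p, 1 < p → Wm1 (x p) * Real.exp (Wm1 (x p)) = x p :=
    fun p hp => (hWm1 _ (hx p hp)).2
  have hgt : ∀ p, 1 < p → -1 < W0 (x p) := fun p hp => by
    refine (hm0 p hp).lt_of_ne fun h => (hx p hp).1.ne ?_
    change -(Real.exp 1)⁻¹ = x p
    rw [← he0 p hp, ← h, neg_one_mul_exp_neg_one]
  have hpos : ∀ p, 1 < p → 0 < f p := fun p hp => by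
    have := hneg p hp
    have := hm1 p hp
    rw [hf]
    exact div_pos (by linarith) (by linarith)
  refine ⟨fun p hp => ⟨hpos p hp, ?_⟩, ?_, ?_, ?_⟩
  · have := hgt p hp
    have := hm1 p hp
    rw [hf, div_lt_one (by linarith)]
    linarith
  · intro p hp q hq hpq
    have hxpq : x q < x p := one_sub_div_exp_one_mul_strictAntiOn hp hq hpq
    have h0 : W0 (x q) < W0 (x p) := by
      refine (strictMonoOn_mul_exp.lt_iff_lt (hm0 q hq) (hm0 p hp)).1 ?_
      simpa only [he0 p hp, he0 q hq] using hxpq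
    have h1 : Wm1 (x p) < Wm1 (x q) := by
      refine (strictAntiOn_mul_exp.lt_iff_gt (hm1 q hq) (hm1 p hp)).1 ?_
      simpa only [he1 p hp, he1 q hq] using hxpq
    have := hneg p hp
    have := hm1 q hq
    rw [hf, hf]
    exact div_lt_div₀ (by linarith) (by linarith) (by linarith) (by linarith)
  · have hlim : Tendsto (fun p : ℝ => 1 - p⁻¹) (nhdsWithin 1 (Set.Ioi 1)) (nhds 0) := by
      have h : ContinuousAt (fun p : ℝ => 1 - p⁻¹) 1 :=
        continuousAt_const.sub (continuousAt_inv₀ one_ne_zero)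
      simpa [ContinuousAt] using h.tendsto.mono_left nhdsWithin_le_nhds
    refine tendsto_of_tendsto_of_tendsto_of_le_of_le' tendsto_const_nhds hlim ?_ ?_
    · filter_upwards [self_mem_nhdsWithin] with p hp using (hpos p hp).le
    · filter_upwards [self_mem_nhdsWithin] with p (hp : 1 < p)
      have h1 := hm1 p hp
      have hle : f p ≤ -W0 (x p) := by
        rw [hf]
        exact div_le_self (by linarith [hneg p hp]) (by linarith)
      have hexp : (Real.exp 1)⁻¹ ≤ Real.exp (W0 (x p)) := by
        rw [← Real.exp_neg]
        exact Real.exp_le_exp.2 (hm0 p hp)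
      have hxp : x p = (Real.exp 1)⁻¹ * (p⁻¹ - 1) := one_sub_div_exp_one_mul (by positivity)
      refine hle.trans (le_of_mul_le_mul_left ?_ (inv_pos.2 (Real.exp_pos 1)))
      nlinarith [he0 p hp, hneg p hp]
  · have hxlim : Tendsto x atTop (nhds (-1 * Real.exp (-1))) := by
      rw [neg_one_mul_exp_neg_one]
      exact tendsto_one_sub_div_exp_one_mul_atTop
    have h0 : Tendsto (fun p => W0 (x p)) atTop (nhds (-1)) := by
      refine tendsto_order.2 ⟨fun c hc => ?_, fun c hc => ?_⟩
      · filter_upwards [eventually_gt_atTop 1] with p hp using hc.trans_le (hm0 p hp)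
      · have hlt : -1 * Real.exp (-1) < c * Real.exp c :=
          strictMonoOn_mul_exp Set.self_mem_Ici (Set.mem_Ici.2 hc.le) hc
        filter_upwards [eventually_gt_atTop 1, hxlim.eventually_lt_const hlt] with p hp hpc
        refine (strictMonoOn_mul_exp.lt_iff_lt (hm0 p hp) (Set.mem_Ici.2 hc.le)).1 ?_
        simpa only [he0 p hp] using hpc
    have h1 : Tendsto (fun p => Wm1 (x p)) atTop (nhds (-1)) := by
      refine tendsto_order.2 ⟨fun c hc => ?_, fun c hc => ?_⟩
      · have hlt : -1 * Real.exp (-1) < c * Real.exp c :=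
          strictAntiOn_mul_exp (Set.mem_Iic.2 hc.le) Set.self_mem_Iic hc
        filter_upwards [eventually_gt_atTop 1, hxlim.eventually_lt_const hlt] with p hp hpc
        refine (strictAntiOn_mul_exp.lt_iff_gt (hm1 p hp) (Set.mem_Iic.2 hc.le)).1 ?_
        simpa only [he1 p hp] using hpc
      · filter_upwards [eventually_gt_atTop 1] with p hp using (hm1 p hp).trans_lt hc
    have h := h0.neg.div h1.neg (by norm_num)
    rw [div_self (by norm_num)] at h
    exact h.congr fun p => (hf p).symm
end
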